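/- arXiv:math/0610980 — 2 statements merged into one kernel-verified Lean document; each statement's English description precedes it below -/
import Mathlib

section
/- Let Γ be a finite connected triangle-free simplicial graph with at least two edges. The kernel K_0 of the homomorphism R_0 = ∏_{v∈V0} R_{J_v} : Out⁰(A_Γ) → ∏_{v∈V0} Out(A_{J_v}) is a finitely generated free abelian group, generated by the classes of partial conjugations by separating vertices v of single non-leaf connected components of Γ − {v}. If Γ is a star, K_0 is trivial; otherwise K_0 has rank Σ_{v∈V0} (δ_C(v) − ℓ(v) − 1), where δ_C(v) is the number of connected components of Γ − {v} and ℓ(v) is the number of leaves adjacent to v. -/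
noncomputable section

/-! ### Outer automorphism groups -/

/-- The subgroup of inner automorphisms of `G` inside `MulAut G`. -/
def Inn (G : Type*) [Group G] : Subgroup (MulAut G) := (MulAut.conj : G →* MulAut G).range

instance Inn.normal (G : Type*) [Group G] : (Inn G).Normal := by
  constructor
  intro n hn φ
  obtain ⟨g, rfl⟩ := hn
  refine ⟨φ g, ?_⟩
  ext x
  simp [MulAut.conj_apply, MulAut.mul_apply, map_mul, map_inv, mul_assoc]

/-- The outer automorphism group of `G`. -/
abbrev Out (G : Type*) [Group G] := MulAut G ⧸ Inn G

/-! ### Right-angled Artin groups -/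

variable {V : Type*}

/-- The commutator relations defining a right-angled Artin group. -/
def raagRels (Γ : SimpleGraph V) : Set (FreeGroup V) :=
  {r | ∃ v w : V, Γ.Adj v w ∧
    r = FreeGroup.of v * FreeGroup.of w * (FreeGroup.of v)⁻¹ * (FreeGroup.of w)⁻¹}

/-- The right-angled Artin group associated to a simple graph. -/
abbrev RAAG (Γ : SimpleGraph V) := PresentedGroup (raagRels Γ)

/-- The generator of `RAAG Γ` corresponding to a vertex. -/
def raagGen (Γ : SimpleGraph V) (v : V) : RAAG Γ := PresentedGroup.of v

/-- The special subgroup generated by the vertices in `Θ`. -/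
def SpecialSubgroup (Γ : SimpleGraph V) (Θ : Set V) : Subgroup (RAAG Γ) :=
  Subgroup.closure (raagGen Γ '' Θ)

/-! ### Graph-theoretic notions -/

/-- The link of a vertex. -/
def lk (Γ : SimpleGraph V) (v : V) : Set V := Γ.neighborSet v

/-- The (closed) star of a vertex. -/
def starOf (Γ : SimpleGraph V) (v : V) : Set V := insert v (Γ.neighborSet v)

/-- `Θ⊥`: the intersection of the closed stars of the vertices of `Θ`. -/
def perp (Γ : SimpleGraph V) (Θ : Set V) : Set V := ⋂ v ∈ Θ, starOf Γ v

/-- A leaf is a vertex of valence one. -/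
def IsLeaf (Γ : SimpleGraph V) (v : V) : Prop := ∃ w, Γ.neighborSet v = {w}

/-- The vertex set of the maximal join `J_v = L_v * L_v⊥` associated to a vertex `v`. -/
def JoinOf (Γ : SimpleGraph V) (v : V) : Set V := lk Γ v ∪ perp Γ (lk Γ v)

/-- A vertex is cyclic if `L_v⊥ = {v}`. -/
def IsCyclicVertex (Γ : SimpleGraph V) (v : V) : Prop := perp Γ (lk Γ v) = {v}

/-- `C` is a connected component of the full subgraph of `Γ` spanned by `S`. -/
def IsComponentOf (Γ : SimpleGraph V) (S C : Set V) : Prop :=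
  C ⊆ S ∧ C.Nonempty ∧ (Γ.induce C).Connected ∧
    ∀ x ∈ C, ∀ y ∈ S, Γ.Adj x y → y ∈ C

/-- A separating vertex: `Γ − {v}` is disconnected. -/
def IsSeparating (Γ : SimpleGraph V) (v : V) : Prop :=
  Set.Nonempty ({v}ᶜ : Set V) ∧ ¬ (Γ.induce ({v}ᶜ : Set V)).Connected

/-- `δ_C(v)`: the number of connected components of `Γ − {v}`. -/
noncomputable def deltaC (Γ : SimpleGraph V) (v : V) : ℕ :=
  {C : Set V | IsComponentOf Γ ({v}ᶜ : Set V) C}.ncard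

/-- `ℓ(v)`: the number of leaves adjacent to `v`. -/
noncomputable def nAdjLeaves (Γ : SimpleGraph V) (v : V) : ℕ :=
  {w : V | Γ.Adj v w ∧ IsLeaf Γ w}.ncard

/-- A twig at `v`: a non-singleton component of `Γ − {v}` contained in the ball of
radius 2 about `v` (as a metric space, so every edge must have an endpoint adjacent
to `v`). -/
def IsTwigOf (Γ : SimpleGraph V) (v : V) (C : Set V) : Prop :=
  IsComponentOf Γ ({v}ᶜ : Set V) C ∧ (¬ ∃ w, C = {w}) ∧
  (∀ x ∈ C, Γ.dist v x ≤ 2) ∧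
  ∀ x ∈ C, ∀ y ∈ C, Γ.Adj x y → (Γ.Adj v x ∨ Γ.Adj v y)

/-- `τ(v)`: the number of twigs at `v`. -/
noncomputable def nTwigs (Γ : SimpleGraph V) (v : V) : ℕ := {C : Set V | IsTwigOf Γ v C}.ncard

/-- `Γ` is the star `{v} * W`. -/
def IsStarGraph (Γ : SimpleGraph V) (v : V) : Prop :=
  ∀ x y, Γ.Adj x y ↔ (x = v ∧ y ≠ v) ∨ (y = v ∧ x ≠ v)

/-- The link-equivalence class of `v` is maximal. -/
def HasMaximalLink (Γ : SimpleGraph V) (v : V) : Prop :=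
  ∀ w, lk Γ v ⊆ lk Γ w → lk Γ w = lk Γ v

/-- `V0` is a set of representatives, one from each maximal link-equivalence class
(with the convention `V0 = {v}` when `Γ` is a star `{v} * W`). -/
def IsV0 (Γ : SimpleGraph V) (V0 : Set V) : Prop :=
  (∃ v, IsStarGraph Γ v ∧ V0 = {v}) ∨
  ((¬ ∃ v, IsStarGraph Γ v) ∧
    (∀ v ∈ V0, HasMaximalLink Γ v) ∧
    (∀ v ∈ V0, ∀ w ∈ V0, lk Γ v = lk Γ w → v = w) ∧
    (∀ w, HasMaximalLink Γ w → ∃ v ∈ V0, lk Γ v = lk Γ w))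

/-- A join `U * W` (as a full subgraph of `Γ`): a complete bipartite full subgraph. -/
def IsJoin (Γ : SimpleGraph V) (U W : Set V) : Prop :=
  U.Nonempty ∧ W.Nonempty ∧ Disjoint U W ∧
  (∀ u ∈ U, ∀ w ∈ W, Γ.Adj u w) ∧
  (∀ u ∈ U, ∀ u' ∈ U, ¬ Γ.Adj u u') ∧
  (∀ w ∈ W, ∀ w' ∈ W, ¬ Γ.Adj w w')

/-- A maximal join: a join not properly contained in any other join subgraph. -/
def IsMaximalJoin (Γ : SimpleGraph V) (U W : Set V) : Prop :=
  IsJoin Γ U W ∧ ∀ U' W', IsJoin Γ U' W' → U ∪ W ⊆ U' ∪ W' → U ∪ W = U' ∪ W'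

/-! ### Generating automorphisms and `Aut⁰`, `Out⁰` -/

/-- `φ` is the inversion at the vertex `v`. -/
def IsInversionAt (Γ : SimpleGraph V) (φ : MulAut (RAAG Γ)) (v : V) : Prop :=
  φ (raagGen Γ v) = (raagGen Γ v)⁻¹ ∧ ∀ w, w ≠ v → φ (raagGen Γ w) = raagGen Γ w

/-- `φ` conjugates the generators in `C` by `v` and fixes all other generators. -/
def IsPartialConjBy (Γ : SimpleGraph V) (φ : MulAut (RAAG Γ)) (v : V) (C : Set V) : Prop :=
  (∀ x ∈ C, φ (raagGen Γ x) = (raagGen Γ v)⁻¹ * raagGen Γ x * raagGen Γ v) ∧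
  (∀ x, x ∉ C → φ (raagGen Γ x) = raagGen Γ x)

/-- `φ` is the (right) transvection `w ↦ wv` (defined when `st(v) ⊇ lk(w)`). -/
def IsTransvection (Γ : SimpleGraph V) (φ : MulAut (RAAG Γ)) (w v : V) : Prop :=
  v ≠ w ∧ lk Γ w ⊆ starOf Γ v ∧
  φ (raagGen Γ w) = raagGen Γ w * raagGen Γ v ∧
  ∀ x, x ≠ w → φ (raagGen Γ x) = raagGen Γ x

/-- The group of pure automorphisms `Aut⁰(A_Γ)`. -/
def Aut0 (Γ : SimpleGraph V) : Subgroup (MulAut (RAAG Γ)) :=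
  Subgroup.closure
    ({φ | φ ∈ Inn (RAAG Γ)} ∪ {φ | ∃ v, IsInversionAt Γ φ v} ∪
     {φ | ∃ v C, IsComponentOf Γ ((starOf Γ v)ᶜ) C ∧ IsPartialConjBy Γ φ v C} ∪
     {φ | ∃ w v, IsTransvection Γ φ w v})

/-- The group of pure outer automorphisms `Out⁰(A_Γ)`. -/
def Out0 (Γ : SimpleGraph V) : Subgroup (Out (RAAG Γ)) :=
  (Aut0 Γ).map (QuotientGroup.mk' (Inn (RAAG Γ)))


/-! ### The kernel `K_0` of the restriction homomorphism `R_0` -/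

/-- The set of outer automorphism classes of partial conjugations by a separating
vertex `v` of a single non-leaf connected component of `Γ − {v}`. -/
def K0gens (Γ : SimpleGraph V) : Set (Out (RAAG Γ)) :=
  {φ | ∃ ψ : MulAut (RAAG Γ), QuotientGroup.mk' (Inn (RAAG Γ)) ψ = φ ∧
    ∃ v C, IsSeparating Γ v ∧ IsComponentOf Γ ({v}ᶜ : Set V) C ∧ (¬ ∃ w, C = {w}) ∧
      IsPartialConjBy Γ ψ v C}

/-- The kernel of `R_0 = ∏_{v ∈ V0} R_{J_v}`: the set of pure outer automorphism
classes which restrict to an inner automorphism on each `A_{J_v}`, i.e. which, for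
each `v ∈ V0`, admit a representative in `Aut⁰(A_Γ)` fixing `A_{J_v}` pointwise. -/
def K0Set (Γ : SimpleGraph V) (V0 : Set V) : Set (Out (RAAG Γ)) :=
  {φ | φ ∈ Out0 Γ ∧ ∀ v ∈ V0, ∃ ψ : MulAut (RAAG Γ), ψ ∈ Aut0 Γ ∧
    QuotientGroup.mk' (Inn (RAAG Γ)) ψ = φ ∧
    ∀ x ∈ SpecialSubgroup Γ (JoinOf Γ v), ψ x = x}

/-! ### Centralizers in HNN extensions -/

open HNNExtension HNNExtension.NormalWord in
theorem HNNExtension.mem_closure_of_commute_t {G : Type*} [Group G] (L : Subgroup G)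
    (g : HNNExtension G L L (MulEquiv.refl L)) (hg : Commute g HNNExtension.t) :
    g ∈ Subgroup.closure (HNNExtension.of '' (L : Set G) ∪ {HNNExtension.t}) := by
  set M : Subgroup (HNNExtension G L L (MulEquiv.refl L)) :=
    Subgroup.closure (of '' (L : Set G) ∪ {t})
  have htM : (t : HNNExtension G L L (MulEquiv.refl L)) ∈ M :=
    Subgroup.subset_closure (Or.inr rfl)
  have hLM : ∀ l ∈ L, (of l : HNNExtension G L L (MulEquiv.refl L)) ∈ M :=
    fun l hl => Subgroup.subset_closure (Or.inl ⟨l, hl, rfl⟩)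
  have hLt : ∀ l ∈ L, Commute (of l : HNNExtension G L L (MulEquiv.refl L)) t :=
    fun l hl => (HNNExtension.t_mul_of (φ := MulEquiv.refl L) ⟨l, hl⟩).symm
  have hts : ∀ u : ℤˣ, toSubgroup L L u = L := by
    intro u
    rcases Int.units_eq_one_or u with rfl | rfl <;> rfl
  have key : ∀ n : ℕ, ∀ w : ReducedWord G L L, w.toList.length = n →
      Commute (w.prod (MulEquiv.refl L)) t → w.prod (MulEquiv.refl L) ∈ M := by
    intro n
    induction n with
    | zero =>
      rintro ⟨h, l, hl⟩ hn hc
      obtain rfl : l = [] := List.length_eq_zero_iff.1 hn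
      let w₁ : ReducedWord G L L := ⟨h, [(1, 1)], by simp⟩
      let w₂ : ReducedWord G L L := ⟨1, [(1, h)], by simp⟩
      have e : w₁.prod (MulEquiv.refl L) = w₂.prod (MulEquiv.refl L) := by
        simpa [w₁, w₂, ReducedWord.prod] using hc.eq
      have := (ReducedWord.map_fst_eq_and_of_prod_eq _ e).2 1 (by simp [w₁])
      rw [hts] at this
      have hh : h ∈ L := by simpa [w₁, w₂] using this
      simpa [ReducedWord.prod] using hLM h hh
    | succ n ih =>
      rintro ⟨h, l, hl⟩ hn hc
      have strip : ∀ (w : ReducedWord G L L) (x y : HNNExtension G L L (MulEquiv.refl L)),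
          w.toList.length = n → x ∈ M → y ∈ M → Commute x t → Commute y t →
          ReducedWord.prod (MulEquiv.refl L) ⟨h, l, hl⟩ = x * w.prod (MulEquiv.refl L) * y →
          ReducedWord.prod (MulEquiv.refl L) ⟨h, l, hl⟩ ∈ M := by
        intro w x y hw hx hy hxt hyt e
        rw [e]
        refine M.mul_mem (M.mul_mem hx (ih w hw ?_)) hy
        have : w.prod (MulEquiv.refl L) =
            x⁻¹ * ReducedWord.prod (MulEquiv.refl L) ⟨h, l, hl⟩ * y⁻¹ := by
          rw [e]; group
        rw [this]
        exact (hxt.inv_left.mul_left hc).mul_left hyt.inv_left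
      have htz : ∀ z : ℤ, Commute (t ^ z : HNNExtension G L L (MulEquiv.refl L)) t :=
        fun z => (Commute.refl t).zpow_left z
      obtain ⟨l', ⟨e, k⟩, rfl⟩ := List.eq_nil_or_concat' l |>.resolve_left
        (by rintro rfl; simp at hn)
      by_cases hk : k ∈ L
      · refine strip ⟨h, l', (List.isChain_append.1 hl).1⟩ 1 (t ^ (e : ℤ) * of k)
          (by simpa using hn)
          M.one_mem (M.mul_mem (M.zpow_mem htM _) (hLM k hk)) (Commute.one_left _)
          ((htz _).mul_left (hLt k hk)) ?_
        simp [ReducedWord.prod, mul_assoc]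
      by_cases hh : h ∈ L
      · obtain ⟨⟨u, k'⟩, m, hm⟩ := List.exists_cons_of_length_eq_add_one hn
        refine strip ⟨k', m, ?_⟩ (of h * t ^ (u : ℤ)) 1 ?_
          (M.mul_mem (hLM h hh) (M.zpow_mem htM _)) M.one_mem
          ((hLt h hh).mul_left (htz _)) (Commute.one_left _) ?_
        · dsimp only at hm
          rw [hm] at hl
          exact (List.isChain_cons.1 hl).2
        · have := congrArg List.length hm
          simp only [List.length_cons] at this hn ⊢
          omega
        · dsimp only at hm
          simp only [ReducedWord.prod, hm]
          simp [mul_assoc]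
      let w₁ : ReducedWord G L L := ⟨h, (l' ++ [(e, k)]) ++ [(1, 1)], by
        refine List.isChain_append.2 ⟨hl, by simp, ?_⟩
        simp [hts, hk]⟩
      let w₂ : ReducedWord G L L := ⟨1, (1, h) :: (l' ++ [(e, k)]), by
        refine List.isChain_cons.2 ⟨?_, hl⟩
        simp [hts, hh]⟩
      have e : w₁.prod (MulEquiv.refl L) = w₂.prod (MulEquiv.refl L) := by
        simpa [w₁, w₂, ReducedWord.prod, mul_assoc] using hc.eq
      have h3 := (ReducedWord.map_fst_eq_and_of_prod_eq _ e.symm).2 1 (by simp [w₂])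
      rw [hts] at h3
      exact absurd (by simpa [w₁, w₂] using h3) hh
  obtain ⟨d⟩ := TransversalPair.nonempty G L L
  have hprod : (NormalWord.equiv (MulEquiv.refl L) d g).toReducedWord.prod (MulEquiv.refl L) = g :=
    (NormalWord.equiv (MulEquiv.refl L) d).symm_apply_apply g
  have := key _ (NormalWord.equiv (MulEquiv.refl L) d g).toReducedWord rfl
  rw [hprod] at this
  exact this hg

/-! ### Homomorphisms out of right-angled Artin groups -/

section RAAGHoms

variable {Γ : SimpleGraph V}

theorem raagGen_commute {v w : V} (h : Γ.Adj v w) : Commute (raagGen Γ v) (raagGen Γ w) := by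
  have : PresentedGroup.mk (raagRels Γ) (FreeGroup.of v * FreeGroup.of w *
      (FreeGroup.of v)⁻¹ * (FreeGroup.of w)⁻¹) = 1 :=
    PresentedGroup.one_of_mem ⟨v, w, h, rfl⟩
  simp only [map_mul, map_inv] at this
  exact (mul_inv_eq_iff_eq_mul.1 (mul_inv_eq_one.1 this))

/-- The homomorphism out of a right-angled Artin group determined by images of the generators. -/
def raagLift {G : Type*} [Group G] (f : V → G)
    (hf : ∀ v w, Γ.Adj v w → Commute (f v) (f w)) : RAAG Γ →* G :=
  PresentedGroup.toGroup (f := f) (rels := raagRels Γ) (by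
    rintro _ ⟨v, w, h, rfl⟩
    simp [(hf v w h).eq])

@[simp]
theorem raagLift_gen {G : Type*} [Group G] (f : V → G)
    (hf : ∀ v w, Γ.Adj v w → Commute (f v) (f w)) (v : V) :
    raagLift f hf (raagGen Γ v) = f v :=
  PresentedGroup.toGroup.of _

theorem raag_hom_ext {G : Type*} [Group G] {f g : RAAG Γ →* G}
    (h : ∀ v, f (raagGen Γ v) = g (raagGen Γ v)) : f = g :=
  PresentedGroup.ext h

theorem raag_aut_ext {φ ψ : MulAut (RAAG Γ)}
    (h : ∀ v, φ (raagGen Γ v) = ψ (raagGen Γ v)) : φ = ψ := by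
  have : φ.toMonoidHom = ψ.toMonoidHom := raag_hom_ext h
  ext x
  exact DFunLike.congr_fun this x

open Classical in
/-- The retraction of a right-angled Artin group onto a special subgroup. -/
def raagRetract (Γ : SimpleGraph V) (Θ : Set V) : RAAG Γ →* RAAG Γ :=
  raagLift (fun v => if v ∈ Θ then raagGen Γ v else 1) (by
    intro v w h
    split_ifs
    · exact raagGen_commute h
    all_goals simp)

theorem raagGen_mem_specialSubgroup {Θ : Set V} {v : V} (hv : v ∈ Θ) :
    raagGen Γ v ∈ SpecialSubgroup Γ Θ :=
  Subgroup.subset_closure ⟨v, hv, rfl⟩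

theorem raagRetract_eq_self {Θ : Set V} {g : RAAG Γ} (hg : g ∈ SpecialSubgroup Γ Θ) :
    raagRetract Γ Θ g = g := by
  refine MonoidHom.eqOn_closure (f := raagRetract Γ Θ) (g := MonoidHom.id _) ?_ hg
  rintro _ ⟨v, hv, rfl⟩
  simp [raagRetract, hv]

theorem specialSubgroup_inter {Θ Θ' : Set V} {g : RAAG Γ} (hg : g ∈ SpecialSubgroup Γ Θ)
    (hg' : g ∈ SpecialSubgroup Γ Θ') : g ∈ SpecialSubgroup Γ (Θ ∩ Θ') := by
  classical
  rw [← raagRetract_eq_self hg']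
  suffices SpecialSubgroup Γ Θ ≤ (SpecialSubgroup Γ (Θ ∩ Θ')).comap (raagRetract Γ Θ') from this hg
  refine (Subgroup.closure_le _).2 ?_
  rintro _ ⟨v, hv, rfl⟩
  by_cases h : v ∈ Θ'
  · simpa [raagRetract, h] using
      raagGen_mem_specialSubgroup (Γ := Γ) (show v ∈ Θ ∩ Θ' from ⟨hv, h⟩)
  · simp [raagRetract, h]

open Classical in
/-- The exponent sum of the generator `v`. -/
def expSum (Γ : SimpleGraph V) (v : V) : RAAG Γ →* Multiplicative ℤ :=
  raagLift (fun w => if w = v then Multiplicative.ofAdd 1 else 1) fun _ _ _ => Commute.all _ _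

@[simp]
theorem expSum_gen_self (v : V) : expSum Γ v (raagGen Γ v) = Multiplicative.ofAdd 1 := by
  simp [expSum]

theorem expSum_gen_of_ne {v w : V} (h : w ≠ v) : expSum Γ v (raagGen Γ w) = 1 := by
  simp [expSum, h]

/-! ### Centralizers in right-angled Artin groups -/

theorem mem_star_of_commute {a : V} {g : RAAG Γ} (hg : Commute g (raagGen Γ a)) :
    g ∈ SpecialSubgroup Γ (starOf Γ a) := by
  classical
  set L := SpecialSubgroup Γ (lk Γ a) with hL
  let θ : RAAG Γ →* HNNExtension (RAAG Γ) L L (MulEquiv.refl L) :=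
    raagLift (fun x => if x = a then HNNExtension.t else HNNExtension.of (raagGen Γ x)) (by
      have ht : ∀ x, Γ.Adj a x → Commute HNNExtension.t
          (HNNExtension.of (raagGen Γ x) : HNNExtension (RAAG Γ) L L (MulEquiv.refl L)) :=
        fun x hx => HNNExtension.t_mul_of (φ := MulEquiv.refl L)
          ⟨raagGen Γ x, raagGen_mem_specialSubgroup hx⟩
      intro v w h
      split_ifs with h1 h2 h2
      · exact Commute.refl _
      · exact ht w (h1 ▸ h)
      · exact (ht v (h2 ▸ h.symm)).symm
      · exact (raagGen_commute h).map HNNExtension.of)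
  have hLa : ∀ l ∈ L, Commute (raagGen Γ a) l := by
    intro l hl
    have : L ≤ Subgroup.centralizer {raagGen Γ a} := by
      refine (Subgroup.closure_le _).2 ?_
      rintro _ ⟨x, hx, rfl⟩
      exact Subgroup.mem_centralizer_singleton_iff.2 (raagGen_commute (Γ := Γ) hx).symm.eq
    exact (Subgroup.mem_centralizer_singleton_iff.1 (this hl)).symm
  let π : HNNExtension (RAAG Γ) L L (MulEquiv.refl L) →* RAAG Γ :=
    HNNExtension.lift (MonoidHom.id _) (raagGen Γ a) fun l => (hLa l l.2).eq
  have hπt : π HNNExtension.t = raagGen Γ a := HNNExtension.lift_t ..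
  have hπof : ∀ x, π (HNNExtension.of x) = x := fun x => HNNExtension.lift_of ..
  have hπ : π.comp θ = MonoidHom.id _ := raag_hom_ext fun v => by
    by_cases h : v = a
    · subst h; simp [hπt, θ]
    · simp [hπof, θ, h]
  have hθ : Commute (θ g) HNNExtension.t := by
    simpa [θ] using hg.map θ
  rw [← MonoidHom.id_apply _ g, ← hπ]
  refine (Subgroup.closure_le (K := (SpecialSubgroup Γ (starOf Γ a)).comap π)).2 ?_
    (HNNExtension.mem_closure_of_commute_t L (θ g) hθ)
  rintro _ (⟨l, hl, rfl⟩ | rfl)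
  · have : L ≤ SpecialSubgroup Γ (starOf Γ a) :=
      Subgroup.closure_mono (Set.image_mono (Set.subset_insert _ _))
    simpa [hπof] using this hl
  · simpa [hπt] using
      raagGen_mem_specialSubgroup (Γ := Γ) (show a ∈ starOf Γ a from Set.mem_insert a _)

theorem exists_zpow_of_commute_edge (htf : Γ.CliqueFree 3) {a b : V} (hab : Γ.Adj a b) {g : RAAG Γ}
    (ha : Commute g (raagGen Γ a)) (hb : Commute g (raagGen Γ b)) :
    ∃ m n : ℤ, g = raagGen Γ a ^ m * raagGen Γ b ^ n := by
  have h := specialSubgroup_inter (mem_star_of_commute ha) (mem_star_of_commute hb)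
  have hs : starOf Γ a ∩ starOf Γ b ⊆ {a, b} := by
    classical
    rintro x ⟨rfl | hxa, rfl | hxb⟩
    · simp
    · simp
    · simp
    · exact absurd (SimpleGraph.is3Clique_triple_iff.2 ⟨hab, hxa, hxb⟩) (htf {a, b, x})
  have h2 : g ∈ SpecialSubgroup Γ {a, b} := Subgroup.closure_mono (Set.image_mono hs) h
  have hc := raagGen_commute hab
  rw [SpecialSubgroup, Set.image_pair] at h2
  clear h ha hb
  induction h2 using Subgroup.closure_induction with
  | mem x hx =>
    rcases hx with rfl | rfl
    · exact ⟨1, 0, by simp⟩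
    · exact ⟨0, 1, by simp⟩
  | one => exact ⟨0, 0, by simp⟩
  | mul x y _ _ hx hy =>
    obtain ⟨m, n, rfl⟩ := hx
    obtain ⟨m', n', rfl⟩ := hy
    refine ⟨m + m', n + n', ?_⟩
    rw [zpow_add, zpow_add, mul_assoc, mul_assoc, ← mul_assoc (_ ^ n),
      ((hc.zpow_zpow m' n).eq).symm, mul_assoc]
  | inv x _ hx =>
    obtain ⟨m, n, rfl⟩ := hx
    exact ⟨-m, -n, by rw [mul_inv_rev, ← zpow_neg, ← zpow_neg, (hc.zpow_zpow (-m) (-n)).eq]⟩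

end RAAGHoms

/-! ### Components and maximal links -/

section Graph

variable {Γ : SimpleGraph V}

theorem SimpleGraph.Preconnected.apply_eq_of_adj {α : Type*} (h : Γ.Preconnected) {F : V → α}
    (hF : ∀ x y, Γ.Adj x y → F x = F y) (x y : V) : F x = F y := by
  obtain ⟨p⟩ := h x y
  induction p with
  | nil => rfl
  | cons hadj _ ih => exact (hF _ _ hadj).trans ih

theorem SimpleGraph.Preconnected.mem_of_adj (h : Γ.Preconnected) {D : Set V}
    (hD : ∀ x ∈ D, ∀ y, Γ.Adj x y → y ∈ D) {x : V} (hx : x ∈ D) (y : V) : y ∈ D :=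
  (h.apply_eq_of_adj (F := (· ∈ D))
    (fun a b hab => propext ⟨fun ha => hD a ha b hab, fun hb => hD b hb a hab.symm⟩) x y).mp hx

theorem SimpleGraph.Preconnected.exists_adj_of_ne (h : Γ.Preconnected) {x y : V} (hxy : x ≠ y) :
    ∃ z, Γ.Adj x z := by
  by_contra! hx
  exact hxy.symm (h.mem_of_adj (D := {x}) (by rintro _ rfl z hz; exact absurd hz (hx z)) rfl y)

namespace IsComponentOf

variable {S C C' : Set V}

theorem apply_eq {α : Type*} (hC : IsComponentOf Γ S C) {F : V → α}
    (hF : ∀ x ∈ S, ∀ y ∈ S, Γ.Adj x y → F x = F y) {x y : V} (hx : x ∈ C) (hy : y ∈ C) :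
    F x = F y :=
  hC.2.2.1.preconnected.apply_eq_of_adj (F := fun z : C => F z)
    (fun a b hab => hF a (hC.1 a.2) b (hC.1 b.2) hab) ⟨x, hx⟩ ⟨y, hy⟩

theorem subset_of_closed (hC : IsComponentOf Γ S C) {D : Set V}
    (hD : ∀ x ∈ D, ∀ y ∈ S, Γ.Adj x y → y ∈ D) {x : V} (hx : x ∈ C) (hxD : x ∈ D) : C ⊆ D :=
  fun _ hy => (hC.apply_eq (F := (· ∈ D))
    (fun a ha b hb hab => propext ⟨fun h => hD a h b hb hab, fun h => hD b h a ha hab.symm⟩)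
    hx hy).mp hxD

theorem eq_of_mem (hC : IsComponentOf Γ S C) (hC' : IsComponentOf Γ S C') {x : V} (hx : x ∈ C)
    (hx' : x ∈ C') : C = C' :=
  (hC.subset_of_closed hC'.2.2.2 hx hx').antisymm (hC'.subset_of_closed hC.2.2.2 hx' hx)

theorem exists_adj (hC : IsComponentOf Γ S C) (hs : ¬ ∃ w, C = {w}) {x : V} (hx : x ∈ C) :
    ∃ y ∈ C, Γ.Adj x y := by
  by_contra! h
  refine hs ⟨x, Set.Subset.antisymm ?_ (Set.singleton_subset_iff.2 hx)⟩
  refine hC.subset_of_closed ?_ hx rfl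
  rintro _ rfl _ hy hxy
  exact absurd hxy (h _ (hC.2.2.2 _ hx _ hy hxy))

theorem not_singleton (hC : IsComponentOf Γ S C) {x y : V} (hx : x ∈ C) (hy : y ∈ S)
    (hxy : Γ.Adj x y) : ¬ ∃ w, C = {w} := by
  rintro ⟨w, rfl⟩
  have := hC.2.2.2 x hx y hy hxy
  exact hxy.ne (hx.trans this.symm)

theorem isSeparating {v : V} (hC : IsComponentOf Γ {v}ᶜ C) (hC' : IsComponentOf Γ {v}ᶜ C')
    (h : C ≠ C') : IsSeparating Γ v := by
  refine ⟨hC.2.1.mono hC.1, fun hc => h ?_⟩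
  have hu : IsComponentOf Γ {v}ᶜ {v}ᶜ :=
    ⟨subset_rfl, hC.2.1.mono hC.1, hc, fun _ _ _ hy _ => hy⟩
  have key : ∀ D, IsComponentOf Γ {v}ᶜ D → D = {v}ᶜ := by
    intro D hD
    obtain ⟨x, hx⟩ := hD.2.1
    exact hD.eq_of_mem hu hx (hD.1 hx)
  rw [key C hC, key C' hC']

end IsComponentOf

theorem exists_isComponentOf {S : Set V} {w : V} (hw : w ∈ S) :
    ∃ C, IsComponentOf Γ S C ∧ w ∈ C := by
  let T : Set (Set V) := {T | T ⊆ S ∧ w ∈ T ∧ (Γ.induce T).Connected}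
  have h0 : {w} ∈ T := by
    refine ⟨Set.singleton_subset_iff.2 hw, rfl, ?_⟩
    have : Subsingleton ({w} : Set V) := ⟨fun a b => Subtype.ext (a.2.trans b.2.symm)⟩
    have : Nonempty ({w} : Set V) := ⟨⟨w, rfl⟩⟩
    exact SimpleGraph.Connected.mk SimpleGraph.Preconnected.of_subsingleton
  have hwT : w ∈ ⋃₀ T := ⟨_, h0, rfl⟩
  refine ⟨⋃₀ T, ⟨Set.sUnion_subset fun t ht => ht.1, ⟨w, hwT⟩, ?_, ?_⟩, hwT⟩
  · exact SimpleGraph.induce_sUnion_connected_of_pairwise_not_disjoint ⟨_, h0⟩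
      (fun hs ht => ⟨w, hs.2.1, ht.2.1⟩) fun hs => hs.2.2
  · rintro x ⟨t, ht, hx⟩ y hy hxy
    refine ⟨t ∪ {x, y}, ⟨Set.union_subset ht.1 ?_, Or.inl ht.2.1, ?_⟩, Or.inr (by simp)⟩
    · rintro z (rfl | rfl)
      · exact ht.1 hx
      · exact hy
    · exact SimpleGraph.induce_union_connected ht.2.2.preconnected
        (SimpleGraph.induce_pair_connected_of_adj hxy).preconnected ⟨x, hx, by simp⟩

theorem IsSeparating.eq_of_mem_perp (hconn : Γ.Connected) {v x : V} (hv : IsSeparating Γ v)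
    (hx : x ∈ perp Γ (lk Γ v)) : x = v := by
  by_contra hxv
  obtain ⟨C, hC, hxC⟩ := exists_isComponentOf (Γ := Γ) (S := {v}ᶜ) hxv
  have hall : ∀ y, y ∈ insert v C := by
    refine hconn.preconnected.mem_of_adj ?_ (Or.inr hxC)
    rintro a (rfl | ha) b hab
    · right
      rcases Set.mem_iInter₂.1 hx b hab with rfl | hbx
      · exact hxC
      · exact hC.2.2.2 x hxC b hab.ne' hbx.symm
    · by_cases hb : b = v
      · exact Or.inl hb
      · exact Or.inr (hC.2.2.2 a ha b hb hab)
  have : C = {v}ᶜ := hC.1.antisymm fun y hy => (hall y).resolve_left hy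
  exact hv.2 (this ▸ hC.2.2.1)

theorem mem_perp_lk_iff {v x : V} : x ∈ perp Γ (lk Γ v) ↔ lk Γ v ⊆ starOf Γ x := by
  refine Set.mem_iInter₂.trans (forall₂_congr fun y _ => ?_)
  exact or_congr eq_comm (Γ.adj_comm _ _)

theorem HasMaximalLink.of_isSeparating (hconn : Γ.Connected) {v : V} (hv : IsSeparating Γ v) :
    HasMaximalLink Γ v := by
  intro w hw
  rw [hv.eq_of_mem_perp hconn (mem_perp_lk_iff.2 (hw.trans (Set.subset_insert _ _)))]

theorem isStarGraph_of_adj (hconn : Γ.Connected) {v : V}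
    (h : ∀ x y, Γ.Adj x y → x = v ∨ y = v) : IsStarGraph Γ v := by
  have hv : ∀ y, y ≠ v → Γ.Adj v y := by
    intro y hy
    obtain ⟨z, hz⟩ := hconn.preconnected.exists_adj_of_ne hy
    obtain rfl := (h y z hz).resolve_left hy
    exact hz.symm
  intro x y
  constructor
  · intro hxy
    rcases h x y hxy with rfl | rfl
    · exact Or.inl ⟨rfl, hxy.ne'⟩
    · exact Or.inr ⟨rfl, hxy.ne⟩
  · rintro (⟨rfl, hy⟩ | ⟨rfl, hx⟩)
    · exact hv y hy
    · exact (hv x hx).symm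

theorem exists_adj_of_not_star (hconn : Γ.Connected) (hstar : ¬ ∃ c, IsStarGraph Γ c) (w : V) :
    ∃ z, Γ.Adj w z := by
  by_contra! hz
  refine hstar ⟨w, isStarGraph_of_adj hconn fun x y hxy => Or.inl (by_contra fun hx => ?_)⟩
  obtain ⟨z, hz'⟩ := hconn.preconnected.exists_adj_of_ne (Ne.symm hx)
  exact hz z hz'

theorem HasMaximalLink.exists_adj_ne (hconn : Γ.Connected) (hstar : ¬ ∃ c, IsStarGraph Γ c)
    {w : V} (hw : HasMaximalLink Γ w) (u : V) : ∃ y, Γ.Adj w y ∧ y ≠ u := by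
  by_contra! h
  obtain ⟨z, hz⟩ := exists_adj_of_not_star hconn hstar w
  obtain rfl := h z hz
  have hlk : ∀ x, Γ.Adj z x → ∀ y, Γ.Adj x y → y = z := by
    intro x hx y hy
    have : lk Γ x = lk Γ w := hw x fun a ha => by
      rw [h a ha]
      exact hx.symm
    exact h y (this.subset hy)
  have hall : ∀ y, y ∈ starOf Γ z := by
    refine hconn.preconnected.mem_of_adj ?_ (Set.mem_insert z _)
    rintro a (rfl | ha) b hab
    · exact Or.inr hab
    · exact Or.inl (hlk a ha b hab)
  exact hstar ⟨z, isStarGraph_of_adj hconn fun x y hxy =>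
    (hall x).imp_right fun hx => hlk x hx y hxy⟩

theorem IsStarGraph.exists_adj_ne (hE : 2 ≤ Γ.edgeSet.ncard) {c : V} (hc : IsStarGraph Γ c)
    (u : V) : ∃ y, Γ.Adj c y ∧ y ≠ u := by
  by_contra! h
  have : Γ.edgeSet ⊆ {s(c, u)} := by
    intro e he
    induction e with
    | _ x y =>
      have hxy : Γ.Adj x y := he
      rcases (hc x y).1 hxy with ⟨rfl, _⟩ | ⟨rfl, _⟩
      · rw [h y hxy]; rfl
      · rw [h x hxy.symm, Sym2.eq_swap]; rfl
  have := Set.ncard_le_ncard this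
  simp at this
  omega

theorem IsStarGraph.joinOf {c : V} (hc : IsStarGraph Γ c) (x : V) : x ∈ JoinOf Γ c := by
  by_cases hx : x = c
  · subst hx
    exact Or.inr (mem_perp_lk_iff.2 (Set.subset_insert _ _))
  · exact Or.inl ((hc c x).2 (Or.inl ⟨rfl, hx⟩))

theorem exists_maximalLink [Finite V] (Γ : SimpleGraph V) (u : V) :
    ∃ w, HasMaximalLink Γ w ∧ lk Γ u ⊆ lk Γ w ∧ (HasMaximalLink Γ u → w = u) := by
  by_cases hu : HasMaximalLink Γ u
  · exact ⟨u, hu, subset_rfl, fun _ => rfl⟩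
  obtain ⟨m, hm, ⟨w, rfl⟩, hmax⟩ :=
    (Set.toFinite (Set.range (lk Γ))).exists_le_maximal (Set.mem_range_self u)
  exact ⟨w, fun x hx => (hmax ⟨x, rfl⟩ hx).antisymm hx, hm, fun h => absurd h hu⟩

theorem IsV0.exists_adj_ne (hconn : Γ.Connected) (hE : 2 ≤ Γ.edgeSet.ncard) {V0 : Set V}
    (hV0 : IsV0 Γ V0) {w : V} (hw : w ∈ V0) (u : V) : ∃ y, Γ.Adj w y ∧ y ≠ u := by
  rcases hV0 with ⟨v, hv, rfl⟩ | ⟨hstar, hmax, -⟩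
  · obtain rfl : w = v := hw
    exact hv.exists_adj_ne hE u
  · exact (hmax w hw).exists_adj_ne hconn hstar u

theorem IsV0.mem_of_isSeparating (hconn : Γ.Connected) {V0 : Set V} (hV0 : IsV0 Γ V0)
    (hstar : ¬ ∃ c, IsStarGraph Γ c) {v : V} (hv : IsSeparating Γ v) : v ∈ V0 := by
  rcases hV0 with ⟨c, hc, -⟩ | ⟨-, -, -, h⟩
  · exact absurd ⟨c, hc⟩ hstar
  · obtain ⟨v', hv', e⟩ := h v (HasMaximalLink.of_isSeparating hconn hv)
    rwa [← hv.eq_of_mem_perp hconn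
      (mem_perp_lk_iff.2 (e.symm.subset.trans (Set.subset_insert _ _)) : v' ∈ _)]

theorem IsV0.exists_star_subset {V0 : Set V} (hV0 : IsV0 Γ V0)
    (hstar : ¬ ∃ c, IsStarGraph Γ c) {w : V} (hw : HasMaximalLink Γ w) :
    ∃ v ∈ V0, starOf Γ w ⊆ JoinOf Γ v := by
  rcases hV0 with ⟨c, hc, -⟩ | ⟨-, -, -, h⟩
  · exact absurd ⟨c, hc⟩ hstar
  · obtain ⟨v, hv, e⟩ := h w hw
    refine ⟨v, hv, ?_⟩
    rintro x (rfl | hx)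
    · exact Or.inr (mem_perp_lk_iff.2 (e.subset.trans (Set.subset_insert _ _)))
    · exact Or.inl (e.symm.subset hx)

theorem joinOf_subset_component {v w : V} (hw : ∃ y, Γ.Adj w y ∧ y ≠ v)
    {D : Set V} (hD : IsComponentOf Γ {v}ᶜ D) (hwD : w ∈ D) {x : V} (hx : x ∈ JoinOf Γ w)
    (hxv : x ≠ v) : x ∈ D := by
  rcases hx with hx | hx
  · exact hD.2.2.2 w hwD x hxv hx
  · obtain ⟨y, hwy, hyv⟩ := hw
    have hy := hD.2.2.2 w hwD y hyv hwy
    rcases mem_perp_lk_iff.1 hx hwy with rfl | hxy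
    · exact hy
    · exact hD.2.2.2 y hy x hxv hxy.symm

theorem exists_nonleaf_component (hconn : Γ.Connected) (hstar : ¬ ∃ c, IsStarGraph Γ c) (v : V) :
    ∃ C, IsComponentOf Γ {v}ᶜ C ∧ ¬ ∃ w, C = {w} := by
  by_contra! h
  refine hstar ⟨v, isStarGraph_of_adj hconn fun x y hxy => ?_⟩
  by_contra! hne
  obtain ⟨C, hC, hxC⟩ := exists_isComponentOf (Γ := Γ) (S := {v}ᶜ) hne.1
  exact hC.not_singleton hxC hne.2 hxy (h C hC)

theorem exists_maximalLink_mem_component [Finite V] {v : V} {C : Set V}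
    (hC : IsComponentOf Γ {v}ᶜ C) (hs : ¬ ∃ w, C = {w}) : ∃ w ∈ C, HasMaximalLink Γ w := by
  obtain ⟨x, hx⟩ := hC.2.1
  obtain ⟨y, hy, hxy⟩ := hC.exists_adj hs hx
  obtain ⟨a, ha, hxa, -⟩ := exists_maximalLink Γ x
  obtain ⟨b, hb, hyb, -⟩ := exists_maximalLink Γ y
  by_cases hav : a = v
  · by_cases hbv : b = v
    · subst hav
      have h1 : Γ.Adj a y := hxa hxy
      have h2 : Γ.Adj b a := hyb h1.symm
      exact absurd hbv h2.ne
    · exact ⟨b, hC.2.2.2 x hx b hbv (hyb hxy.symm : Γ.Adj b x).symm, hb⟩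
  · exact ⟨a, hC.2.2.2 y hy a hav (hxa hxy : Γ.Adj a y).symm, ha⟩

theorem deltaC_eq [Finite V] (hconn : Γ.Connected) (v : V) :
    deltaC Γ v = {C : Set V | IsComponentOf Γ {v}ᶜ C ∧ ¬ ∃ w, C = {w}}.ncard + nAdjLeaves Γ v := by
  have hleaf : nAdjLeaves Γ v = {C : Set V | IsComponentOf Γ {v}ᶜ C ∧ ∃ w, C = {w}}.ncard := by
    rw [nAdjLeaves, ← Set.ncard_image_of_injective _ Set.singleton_injective]
    congr 1
    ext C
    constructor
    · rintro ⟨w, ⟨hvw, u, hu⟩, rfl⟩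
      obtain rfl : v = u := hu.subset hvw.symm
      refine ⟨?_, w, rfl⟩
      obtain ⟨C, hC, hw⟩ := exists_isComponentOf (Γ := Γ) (S := {v}ᶜ) (w := w) hvw.ne'
      have : C = {w} := by
        refine Set.Subset.antisymm (hC.subset_of_closed ?_ hw rfl) (Set.singleton_subset_iff.2 hw)
        rintro _ rfl y hy hwy
        exact absurd (hu.subset hwy) hy
      exact this ▸ hC
    · rintro ⟨hC, w, rfl⟩
      have hwv : w ≠ v := hC.1 rfl
      obtain ⟨z, hz⟩ := hconn.preconnected.exists_adj_of_ne hwv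
      have key : ∀ z, Γ.Adj w z → z = v := fun z hz => by
        by_contra h
        exact hz.ne' (hC.2.2.2 w rfl z h hz)
      obtain rfl := key z hz
      exact ⟨w, ⟨hz.symm, z, Set.Subset.antisymm key (Set.singleton_subset_iff.2 hz)⟩, rfl⟩
  rw [hleaf, ← Set.ncard_union_eq, deltaC]
  · congr 1
    ext C
    exact ⟨fun h => (em _).symm.imp (⟨h, ·⟩) (⟨h, ·⟩), fun h => h.elim And.left And.left⟩
  · exact Set.disjoint_left.2 fun C h1 h2 => h1.2 h2.2

end Graph

/-! ### Partial conjugations -/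

section PartialConj

variable {Γ : SimpleGraph V}

open Classical in
/-- The endomorphism conjugating the generators in `C` by `g`. -/
def partialConjHom (g : RAAG Γ) (C : Set V)
    (hC : ∀ x ∈ C, ∀ y ∉ C, Γ.Adj x y → Commute g (raagGen Γ y)) : RAAG Γ →* RAAG Γ :=
  raagLift (fun x => if x ∈ C then g⁻¹ * raagGen Γ x * g else raagGen Γ x) (by
    have key : ∀ x ∈ C, ∀ y ∉ C, Γ.Adj x y → Commute (g⁻¹ * raagGen Γ x * g) (raagGen Γ y) :=
      fun x hx y hy hxy => ((hC x hx y hy hxy).inv_left.mul_left (raagGen_commute hxy)).mul_left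
        (hC x hx y hy hxy)
    intro x y hxy
    split_ifs with hx hy hy
    · simpa [MulAut.conj_apply] using (raagGen_commute hxy).map (MulAut.conj g⁻¹)
    · exact key x hx y hy hxy
    · exact (key y hy x hx hxy.symm).symm
    · exact raagGen_commute hxy)

theorem exists_isPartialConjBy {v : V} {C : Set V} (hv : v ∉ C)
    (hC : ∀ x ∈ C, ∀ y ∉ C, Γ.Adj x y → y ∈ starOf Γ v) :
    ∃ φ : MulAut (RAAG Γ), IsPartialConjBy Γ φ v C := by
  have hC' : ∀ x ∈ C, ∀ y ∉ C, Γ.Adj x y → Commute (raagGen Γ v) (raagGen Γ y) := by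
    intro x hx y hy hxy
    rcases hC x hx y hy hxy with rfl | h
    · exact Commute.refl _
    · exact raagGen_commute h
  refine ⟨MonoidHom.toMulEquiv (partialConjHom (raagGen Γ v) C hC')
    (partialConjHom (raagGen Γ v)⁻¹ C fun x hx y hy hxy => (hC' x hx y hy hxy).inv_left)
    (raag_hom_ext fun x => ?_) (raag_hom_ext fun x => ?_), fun x hx => ?_, fun x hx => ?_⟩
  · by_cases hx : x ∈ C <;> simp [partialConjHom, hx, hv, mul_assoc]
  · by_cases hx : x ∈ C <;> simp [partialConjHom, hx, hv, mul_assoc]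
  · simp [partialConjHom, hx]
  · simp [partialConjHom, hx]

theorem IsPartialConjBy.mem_Aut0_of_closed [Finite V] {v : V} (C : Set V) :
    C ⊆ (starOf Γ v)ᶜ → (∀ x ∈ C, ∀ y ∉ C, Γ.Adj x y → y ∈ starOf Γ v) →
    ∀ φ : MulAut (RAAG Γ), IsPartialConjBy Γ φ v C → φ ∈ Aut0 Γ := by
  induction C using WellFoundedLT.induction with
  | ind C ih =>
    intro hCv hC φ hφ
    have hv : v ∉ C := fun h => hCv h (Set.mem_insert _ _)
    rcases C.eq_empty_or_nonempty with rfl | ⟨x, hx⟩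
    · have : φ = 1 := raag_aut_ext fun x => by simp [hφ.2 x (by simp)]
      exact this ▸ one_mem _
    obtain ⟨D, hD, hxD⟩ := exists_isComponentOf (Γ := Γ) (hCv hx)
    have hDC : D ⊆ C := hD.subset_of_closed
      (fun a ha b hb hab => by_contra fun h => hb (hC a ha b h hab)) hxD hx
    have hDcl : ∀ a ∈ D, ∀ b ∉ D, Γ.Adj a b → b ∈ starOf Γ v :=
      fun a ha b hb hab => by_contra fun h => hb (hD.2.2.2 a ha b h hab)
    have hEcl : ∀ a ∈ C \ D, ∀ b ∉ C \ D, Γ.Adj a b → b ∈ starOf Γ v := by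
      intro a ha b hb hab
      by_contra h
      by_cases hbC : b ∈ C
      · have hbD : b ∈ D := by_contra fun h => hb ⟨hbC, h⟩
        exact ha.2 (hD.2.2.2 b hbD a (hCv ha.1) hab.symm)
      · exact h (hC a ha.1 b hbC hab)
    obtain ⟨φ₁, h₁⟩ := exists_isPartialConjBy (fun h => hv (hDC h)) hDcl
    obtain ⟨φ₂, h₂⟩ := exists_isPartialConjBy (fun h => hv h.1) hEcl
    have e : φ = φ₁ * φ₂ := raag_aut_ext fun y => by
      rw [MulAut.mul_apply]
      by_cases hyC : y ∈ C
      · by_cases hyD : y ∈ D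
        · rw [h₂.2 y fun h => h.2 hyD, h₁.1 y hyD, hφ.1 y hyC]
        · rw [h₂.1 y ⟨hyC, hyD⟩, map_mul, map_mul, map_inv, h₁.2 y hyD,
            h₁.2 v fun h => hv (hDC h), hφ.1 y hyC]
      · rw [h₂.2 y fun h => hyC h.1, h₁.2 y fun h => hyC (hDC h), hφ.2 y hyC]
    rw [e]
    refine mul_mem (Subgroup.subset_closure (Or.inl (Or.inr ⟨v, D, hD, h₁⟩)))
      (ih _ ?_ (Set.sdiff_subset.trans hCv) hEcl φ₂ h₂)
    exact Set.ssubset_iff_subset_ne.2 ⟨Set.sdiff_subset, fun h => (h.symm.subset hx).2 hxD⟩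

theorem IsPartialConjBy.mem_Aut0 [Finite V] {v : V} {C : Set V} (hC : IsComponentOf Γ {v}ᶜ C)
    {φ : MulAut (RAAG Γ)} (hφ : IsPartialConjBy Γ φ v C) : φ ∈ Aut0 Γ := by
  have hlk : ∀ x, Γ.Adj v x → φ (raagGen Γ x) = raagGen Γ x := by
    intro x hx
    by_cases hxC : x ∈ C
    · rw [hφ.1 x hxC, mul_assoc, ← (raagGen_commute hx).eq, inv_mul_cancel_left]
    · exact hφ.2 x hxC
  refine mem_Aut0_of_closed (v := v) (C \ starOf Γ v) (fun x hx => hx.2) ?_ φ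
    ⟨fun x hx => hφ.1 x hx.1, fun x hx => ?_⟩
  · intro x hx y hy hxy
    by_contra h
    exact hy ⟨hC.2.2.2 x hx.1 y (fun e => h (Or.inl e)) hxy, h⟩
  · by_cases hxC : x ∈ C
    · have : x ∈ starOf Γ v := by_contra fun h => hx ⟨hxC, h⟩
      rcases this with rfl | h
      · exact absurd rfl (hC.1 hxC)
      · exact hlk x h
    · exact hφ.2 x hxC

end PartialConj

/-! ### Automorphisms acting by conjugation on maximal stars -/

section StarConj

variable {Γ : SimpleGraph V}

/-- `φ` acts on the star of `w` as conjugation by `h`. -/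
def ConjOnStar (φ : MulAut (RAAG Γ)) (w : V) (h : RAAG Γ) : Prop :=
  ∀ x ∈ starOf Γ w, φ (raagGen Γ x) = h * raagGen Γ x * h⁻¹

theorem ConjOnStar.mul {φ ψ : MulAut (RAAG Γ)} {w : V} {h k : RAAG Γ} (hφ : ConjOnStar φ w h)
    (hψ : ConjOnStar ψ w k) : ConjOnStar (φ * ψ) w (φ k * h) := by
  intro x hx
  rw [MulAut.mul_apply, hψ x hx, map_mul, map_mul, hφ x hx, map_inv]
  group

theorem ConjOnStar.inv {φ : MulAut (RAAG Γ)} {w : V} {h : RAAG Γ} (hφ : ConjOnStar φ w h) :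
    ConjOnStar φ⁻¹ w (φ⁻¹ h)⁻¹ := by
  intro x hx
  have e := congrArg (fun g => φ⁻¹ g) (hφ x hx)
  simp only [MulAut.inv_apply_self, map_mul, map_inv] at e
  rw [inv_inv]
  nth_rewrite 2 [e]
  group

/-- The automorphisms acting as a conjugation on the star of each vertex with maximal link. -/
def starConj (Γ : SimpleGraph V) : Subgroup (MulAut (RAAG Γ)) where
  carrier := {φ | ∀ w, HasMaximalLink Γ w → ∃ h, ConjOnStar φ w h}
  mul_mem' hφ hψ w hw := by
    obtain ⟨h, hh⟩ := hφ w hw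
    obtain ⟨k, hk⟩ := hψ w hw
    exact ⟨_, hh.mul hk⟩
  one_mem' w _ := ⟨1, fun x _ => by simp⟩
  inv_mem' hφ w hw := by
    obtain ⟨h, hh⟩ := hφ w hw
    exact ⟨_, hh.inv⟩

theorem conjOnStar_conj (g : RAAG Γ) (w : V) : ConjOnStar (MulAut.conj g) w g :=
  fun _ _ => rfl

open Classical in
theorem IsPartialConjBy.conjOnStar {v : V} {C : Set V} (hC : IsComponentOf Γ {v}ᶜ C)
    {φ : MulAut (RAAG Γ)} (hφ : IsPartialConjBy Γ φ v C) (w : V) :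
    ConjOnStar φ w (if w ∈ C then (raagGen Γ v)⁻¹ else 1) := by
  have hv : v ∉ C := fun h => hC.1 h rfl
  intro x hx
  by_cases hxv : x = v
  · subst hxv
    rw [hφ.2 x hv]
    split_ifs <;> simp
  by_cases hwv : w = v
  · subst hwv
    obtain hx := hx.resolve_left hxv
    rw [if_neg hv]
    by_cases hxC : x ∈ C
    · rw [hφ.1 x hxC, mul_assoc, ← (raagGen_commute hx).eq]; simp
    · simp [hφ.2 x hxC]
  have hiff : x ∈ C ↔ w ∈ C := by
    rcases hx with rfl | hx
    · rfl
    · exact ⟨fun h => hC.2.2.2 x h w hwv hx.symm, fun h => hC.2.2.2 w h x hxv hx⟩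
  split_ifs with hw
  · rw [hφ.1 x (hiff.2 hw), inv_inv]
  · simp [hφ.2 x fun h => hw (hiff.1 h)]

theorem commute_of_conj_eq {G : Type*} [Group G] {h k x : G} (e : h * x * h⁻¹ = k * x * k⁻¹) :
    Commute (h⁻¹ * k) x := by
  have : h * x * h⁻¹ * k = k * x := by rw [e]; group
  change h⁻¹ * k * x = x * (h⁻¹ * k)
  rw [mul_assoc, ← this]
  group

theorem expSum_eq_one_of_mem {v : V} {Θ : Set V} (hv : v ∉ Θ) {g : RAAG Γ}
    (hg : g ∈ SpecialSubgroup Γ Θ) : expSum Γ v g = 1 := by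
  suffices SpecialSubgroup Γ Θ ≤ (expSum Γ v).ker from this hg
  refine (Subgroup.closure_le _).2 ?_
  rintro _ ⟨x, hx, rfl⟩
  exact expSum_gen_of_ne (fun e => hv (e ▸ hx))

theorem expSum_eq_of_not_mem_star {v u : V} (hv : v ∉ starOf Γ u) {h k : RAAG Γ}
    (e : h * raagGen Γ u * h⁻¹ = k * raagGen Γ u * k⁻¹) : expSum Γ v h = expSum Γ v k := by
  have := expSum_eq_one_of_mem hv (mem_star_of_commute (commute_of_conj_eq e))
  rw [map_mul, map_inv] at this
  exact inv_mul_eq_one.1 this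

theorem expSum_eq_of_edge (htf : Γ.CliqueFree 3) {v a b : V} (hab : Γ.Adj a b) (ha : a ≠ v)
    (hb : b ≠ v) {h k : RAAG Γ} (ea : h * raagGen Γ a * h⁻¹ = k * raagGen Γ a * k⁻¹)
    (eb : h * raagGen Γ b * h⁻¹ = k * raagGen Γ b * k⁻¹) : expSum Γ v h = expSum Γ v k := by
  obtain ⟨m, n, e⟩ := exists_zpow_of_commute_edge htf hab (commute_of_conj_eq ea)
    (commute_of_conj_eq eb)
  have := congrArg (expSum Γ v) e
  rw [map_mul, map_inv, map_mul, map_zpow, map_zpow, expSum_gen_of_ne ha, expSum_gen_of_ne hb,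
    one_zpow, one_zpow, mul_one] at this
  exact inv_mul_eq_one.1 this

theorem ConjOnStar.expSum_eq (htf : Γ.CliqueFree 3) (hconn : Γ.Connected)
    (hstar : ¬ ∃ c, IsStarGraph Γ c) {φ : MulAut (RAAG Γ)} {w : V} (hw : HasMaximalLink Γ w)
    {h k : RAAG Γ} (hh : ConjOnStar φ w h) (hk : ConjOnStar φ w k) {v : V} (hv : w ≠ v) :
    expSum Γ v h = expSum Γ v k := by
  obtain ⟨y, hwy, hyv⟩ := hw.exists_adj_ne hconn hstar v
  exact expSum_eq_of_edge htf hwy hv hyv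
    ((hh w (Or.inl rfl)).symm.trans (hk w (Or.inl rfl)))
    ((hh y (Or.inr hwy)).symm.trans (hk y (Or.inr hwy)))

variable [Finite V]

theorem expSum_eq_of_component (htf : Γ.CliqueFree 3) (hconn : Γ.Connected)
    (hstar : ¬ ∃ c, IsStarGraph Γ c) {φ : MulAut (RAAG Γ)} {h : V → RAAG Γ}
    (hφ : ∀ w, HasMaximalLink Γ w → ConjOnStar φ w (h w)) {v : V} {C : Set V}
    (hC : IsComponentOf Γ {v}ᶜ C) {w w' : V} (hwC : w ∈ C) (hwC' : w' ∈ C)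
    (hw : HasMaximalLink Γ w) (hw' : HasMaximalLink Γ w') :
    expSum Γ v (h w) = expSum Γ v (h w') := by
  classical
  choose n hn using exists_adj_of_not_star hconn hstar
  choose p hp hsub hid using exists_maximalLink Γ
  have hsub' : ∀ {u y}, Γ.Adj u y → Γ.Adj (p u) y := fun {u _} hy => hsub u hy
  let F : V → Multiplicative ℤ := fun u => expSum Γ v (h (if p u = v then p (n u) else p u))
  have hF : ∀ u, HasMaximalLink Γ u → u ≠ v → F u = expSum Γ v (h u) := by
    intro u hu huv
    simp only [F, hid u hu, if_neg huv]
  rw [← hF w hw (hC.1 hwC), ← hF w' hw' (hC.1 hwC')]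
  have hdeg : ∀ x y, x ≠ v → Γ.Adj x y → p x = v → p y ≠ v ∧ F x = F y := by
    intro x y hx hxy hpx
    have hvy : Γ.Adj v y := hpx ▸ hsub' hxy
    have hpy : p y ≠ v := (hsub' hvy.symm).ne
    refine ⟨hpy, ?_⟩
    simp only [F, if_pos hpx, if_neg hpy]
    have hvx : v ∉ starOf Γ x := by
      rintro (e | h)
      · exact hx e.symm
      · have h' := hsub' (show Γ.Adj x v from h)
        rw [hpx] at h'
        exact h'.ne rfl
    exact expSum_eq_of_not_mem_star hvx
      ((hφ _ (hp (n x)) x (Or.inr (hsub' (hn x).symm))).symm.trans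
        (hφ _ (hp y) x (Or.inr (hsub' hxy.symm))))
  refine hC.apply_eq (fun x hx y hy hxy => ?_) hwC hwC'
  by_cases hpx : p x = v
  · exact (hdeg x y hx hxy hpx).2
  by_cases hpy : p y = v
  · exact (hdeg y x hy hxy.symm hpy).2.symm
  simp only [F, if_neg hpx, if_neg hpy]
  have hadj : Γ.Adj (p x) (p y) := (hsub' (hsub' hxy).symm).symm
  exact expSum_eq_of_edge htf hadj hpx hpy
    ((hφ _ (hp x) (p x) (Or.inl rfl)).symm.trans (hφ _ (hp y) (p x) (Or.inr hadj.symm)))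
    ((hφ _ (hp x) (p y) (Or.inr hadj)).symm.trans (hφ _ (hp y) (p y) (Or.inl rfl)))

theorem mem_inn_of_expSum_eq (htf : Γ.CliqueFree 3) (hconn : Γ.Connected)
    (hstar : ¬ ∃ c, IsStarGraph Γ c) {φ : MulAut (RAAG Γ)} {h : V → RAAG Γ}
    (hφ : ∀ w, HasMaximalLink Γ w → ConjOnStar φ w (h w))
    (hexp : ∀ v, HasMaximalLink Γ v → ∀ w w', HasMaximalLink Γ w → HasMaximalLink Γ w' →
      w ≠ v → w' ≠ v → expSum Γ v (h w) = expSum Γ v (h w')) :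
    φ ∈ Inn (RAAG Γ) := by
  choose n hn using exists_adj_of_not_star hconn hstar
  choose p hp hsub hid using exists_maximalLink Γ
  have hsub' : ∀ {u y}, Γ.Adj u y → Γ.Adj (p u) y := fun {u _} hy => hsub u hy
  let d : V → ℤ := fun v => (expSum Γ v (h (p (n v)))).toAdd - (expSum Γ v (h v)).toAdd
  have hd : ∀ v w, HasMaximalLink Γ v → HasMaximalLink Γ w → Γ.Adj v w →
      (expSum Γ v (h w)).toAdd = d v + (expSum Γ v (h v)).toAdd := by
    intro v w hv hw hvw
    rw [hexp v hv w (p (n v)) hw (hp _) hvw.ne' (hsub' (hn v).symm).ne]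
    simp [d]
  have hedge : ∀ v w, HasMaximalLink Γ v → HasMaximalLink Γ w → Γ.Adj v w →
      h v * raagGen Γ v ^ d v = h w * raagGen Γ w ^ d w := by
    intro v w hv hw hvw
    obtain ⟨a, b, e⟩ := exists_zpow_of_commute_edge htf hvw
      (commute_of_conj_eq ((hφ v hv v (Or.inl rfl)).symm.trans (hφ w hw v (Or.inr hvw.symm))))
      (commute_of_conj_eq ((hφ v hv w (Or.inr hvw)).symm.trans (hφ w hw w (Or.inl rfl))))
    have ev := congrArg (fun g => (expSum Γ v g).toAdd) e
    have ew := congrArg (fun g => (expSum Γ w g).toAdd) e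
    simp only [map_mul, map_inv, map_zpow, expSum_gen_self, expSum_gen_of_ne hvw.ne,
      expSum_gen_of_ne hvw.ne', toAdd_mul, toAdd_inv, toAdd_zpow, toAdd_ofAdd, toAdd_one,
      smul_eq_mul, mul_one, mul_zero, add_zero, zero_add] at ev ew
    have h1 := hd v w hv hw hvw
    have h2 := hd w v hw hv hvw.symm
    obtain rfl : a = d v := by linarith
    obtain rfl : b = -d w := by linarith
    rw [inv_mul_eq_iff_eq_mul] at e
    rw [e]
    group
  let H : V → RAAG Γ := fun u => h (p u) * raagGen Γ (p u) ^ d (p u)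
  have hH : ∀ x y, H x = H y := hconn.preconnected.apply_eq_of_adj fun x y hxy =>
    hedge _ _ (hp x) (hp y) (hsub' (hsub' hxy).symm).symm
  obtain ⟨u⟩ := hconn.nonempty
  refine ⟨H u, raag_aut_ext fun x => ?_⟩
  have hx : Γ.Adj (p (n x)) x := hsub' (hn x).symm
  rw [hφ _ (hp (n x)) x (Or.inr hx), hH u (n x), MulAut.conj_apply]
  have := ((raagGen_commute hx).zpow_left (d (p (n x)))).eq
  simp only [H, mul_inv_rev]
  rw [mul_assoc (h _), this]
  group

theorem expSum_apply_of_mem_starConj (hconn : Γ.Connected) (hstar : ¬ ∃ c, IsStarGraph Γ c)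
    {φ : MulAut (RAAG Γ)} (hφ : φ ∈ starConj Γ) (v : V) (g : RAAG Γ) :
    expSum Γ v (φ g) = expSum Γ v g := by
  have : (expSum Γ v).comp φ.toMonoidHom = expSum Γ v := raag_hom_ext fun x => by
    obtain ⟨y, hy⟩ := exists_adj_of_not_star hconn hstar x
    obtain ⟨w, hw, hsub, -⟩ := exists_maximalLink Γ y
    obtain ⟨h, hh⟩ := hφ w hw
    have : φ (raagGen Γ x) = _ := hh x (Or.inr (hsub hy.symm))
    simp [this]
  exact DFunLike.congr_fun this g

end StarConj

/-! ### The kernel of the restriction homomorphism -/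

section Kernel

variable {Γ : SimpleGraph V}

theorem inn_le_aut0 : Inn (RAAG Γ) ≤ Aut0 Γ :=
  fun _ hφ => Subgroup.subset_closure (Or.inl (Or.inl (Or.inl hφ)))

theorem mk_conj_mul (g : RAAG Γ) (φ : MulAut (RAAG Γ)) :
    QuotientGroup.mk' (Inn (RAAG Γ)) (MulAut.conj g * φ) = QuotientGroup.mk' _ φ := by
  rw [map_mul, show QuotientGroup.mk' (Inn (RAAG Γ)) (MulAut.conj g) = 1 from
    (QuotientGroup.eq_one_iff _).2 (MonoidHom.mem_range.2 ⟨g, rfl⟩), one_mul]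

theorem apply_eq_self_of_mem_specialSubgroup {φ : MulAut (RAAG Γ)} {Θ : Set V}
    (h : ∀ x ∈ Θ, φ (raagGen Γ x) = raagGen Γ x) : ∀ g ∈ SpecialSubgroup Γ Θ, φ g = g := by
  intro g hg
  refine MonoidHom.eqOn_closure (f := φ.toMonoidHom) (g := MonoidHom.id _) ?_ hg
  rintro _ ⟨x, hx, rfl⟩
  exact h x hx

theorem IsPartialConjBy.exists_conj_joinOf (hconn : Γ.Connected) {v : V} {C : Set V}
    (hv : IsSeparating Γ v) (hC : IsComponentOf Γ {v}ᶜ C) {φ : MulAut (RAAG Γ)}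
    (hφ : IsPartialConjBy Γ φ v C) {w : V} (hw : ∃ y, Γ.Adj w y ∧ y ≠ v) :
    ∃ g, ∀ x ∈ JoinOf Γ w, φ (raagGen Γ x) = g * raagGen Γ x * g⁻¹ := by
  have hvC : v ∉ C := fun h => hC.1 h rfl
  by_cases hwv : w = v
  · subst hwv
    refine ⟨1, fun x hx => ?_⟩
    have hx' : x ∈ starOf Γ w := hx.elim Or.inr fun h => Or.inl (hv.eq_of_mem_perp hconn h)
    simpa [hvC] using hφ.conjOnStar hC w x hx'
  · obtain ⟨D, hD, hwD⟩ := exists_isComponentOf (Γ := Γ) (S := {v}ᶜ) hwv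
    by_cases hwC : w ∈ C
    · refine ⟨(raagGen Γ v)⁻¹, fun x hx => ?_⟩
      by_cases hxv : x = v
      · subst hxv
        simp [hφ.2 x hvC]
      · rw [hφ.1 x (joinOf_subset_component hw hC hwC hx hxv), inv_inv]
    · refine ⟨1, fun x hx => ?_⟩
      have hxC : x ∉ C := by
        intro hxC
        have hxD := joinOf_subset_component hw hD hwD hx fun e => hvC (e ▸ hxC)
        exact hwC (hD.eq_of_mem hC hxD hxC ▸ hwD)
      simp [hφ.2 x hxC]

theorem K0gens_subset_K0Set [Finite V] (hconn : Γ.Connected) (hE : 2 ≤ Γ.edgeSet.ncard)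
    {V0 : Set V} (hV0 : IsV0 Γ V0) : K0gens Γ ⊆ K0Set Γ V0 := by
  rintro _ ⟨φ, rfl, v, C, hv, hC, -, hφ⟩
  have hφ0 := hφ.mem_Aut0 hC
  refine ⟨⟨φ, hφ0, rfl⟩, fun w hw => ?_⟩
  obtain ⟨g, hg⟩ := hφ.exists_conj_joinOf hconn hv hC (hV0.exists_adj_ne hconn hE hw v)
  refine ⟨MulAut.conj g⁻¹ * φ, mul_mem (inn_le_aut0 ⟨_, rfl⟩) hφ0, mk_conj_mul _ _,
    apply_eq_self_of_mem_specialSubgroup fun x hx => ?_⟩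
  rw [MulAut.mul_apply, hg x hx, MulAut.conj_apply]
  group

/-- `K0Set` as a subgroup. -/
def K0Subgroup (Γ : SimpleGraph V) (V0 : Set V) : Subgroup (Out (RAAG Γ)) where
  carrier := K0Set Γ V0
  mul_mem' := by
    rintro φ φ' ⟨h0, h⟩ ⟨h0', h'⟩
    refine ⟨mul_mem h0 h0', fun v hv => ?_⟩
    obtain ⟨ψ, hψ, e, hx⟩ := h v hv
    obtain ⟨ψ', hψ', e', hx'⟩ := h' v hv
    exact ⟨ψ * ψ', mul_mem hψ hψ', by rw [map_mul, e, e'],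
      fun x hxv => by rw [MulAut.mul_apply, hx' x hxv, hx x hxv]⟩
  one_mem' := ⟨one_mem _, fun _ _ => ⟨1, one_mem _, map_one _, fun _ _ => rfl⟩⟩
  inv_mem' := by
    rintro φ ⟨h0, h⟩
    refine ⟨inv_mem h0, fun v hv => ?_⟩
    obtain ⟨ψ, hψ, e, hx⟩ := h v hv
    refine ⟨ψ⁻¹, inv_mem hψ, by rw [map_inv, e], fun x hxv => ?_⟩
    conv_lhs => rw [← hx x hxv]
    exact MulAut.inv_apply_self _ _ _

theorem closure_K0gens_le [Finite V] (hconn : Γ.Connected) (hE : 2 ≤ Γ.edgeSet.ncard)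
    {V0 : Set V} (hV0 : IsV0 Γ V0) : Subgroup.closure (K0gens Γ) ≤ K0Subgroup Γ V0 :=
  (Subgroup.closure_le _).2 (K0gens_subset_K0Set hconn hE hV0)

theorem K0Set_eq_one_of_star {V0 : Set V} (hV0 : IsV0 Γ V0) (hstar : ∃ c, IsStarGraph Γ c) :
    K0Set Γ V0 = {1} := by
  rcases hV0 with ⟨c, hc, rfl⟩ | ⟨h, -⟩
  · refine Set.Subset.antisymm ?_ (Set.singleton_subset_iff.2 (K0Subgroup Γ {c}).one_mem)
    rintro φ ⟨-, h⟩
    obtain ⟨ψ, -, rfl, hx⟩ := h c rfl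
    have : ψ = 1 := raag_aut_ext fun x => hx _ (raagGen_mem_specialSubgroup (hc.joinOf x))
    rw [this, map_one]
    rfl
  · exact absurd hstar h

theorem K0Subgroup_le_map_starConj {V0 : Set V} (hV0 : IsV0 Γ V0)
    (hstar : ¬ ∃ c, IsStarGraph Γ c) :
    K0Subgroup Γ V0 ≤ (starConj Γ).map (QuotientGroup.mk' (Inn (RAAG Γ))) := by
  rintro φ ⟨-, h⟩
  obtain ⟨Φ, rfl⟩ := QuotientGroup.mk'_surjective _ φ
  refine ⟨Φ, fun w hw => ?_, rfl⟩
  obtain ⟨v, hv, hsub⟩ := hV0.exists_star_subset hstar hw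
  obtain ⟨ψ, -, e, hx⟩ := h v hv
  obtain ⟨_, ⟨g, rfl⟩, rfl⟩ := (QuotientGroup.mk'_eq_mk' _).1 e
  refine ⟨ψ g, fun x hxw => ?_⟩
  rw [MulAut.mul_apply, MulAut.conj_apply, map_mul, map_mul, map_inv,
    hx _ (raagGen_mem_specialSubgroup (hsub hxw))]

/-- The exponent sum at `v` of an element whose conjugation agrees with `φ` on the star of `w`. -/
def starExp [Finite V] (htf : Γ.CliqueFree 3) (hconn : Γ.Connected) (hstar : ¬ ∃ c, IsStarGraph Γ c)
    {v w : V} (hw : HasMaximalLink Γ w) (hwv : w ≠ v) : starConj Γ →* Multiplicative ℤ :=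
  MonoidHom.mk' (fun φ => expSum Γ v (φ.2 w hw).choose) fun φ ψ => by
    have h := (φ.2 w hw).choose_spec.mul (ψ.2 w hw).choose_spec
    rw [((φ * ψ).2 w hw).choose_spec.expSum_eq htf hconn hstar hw h hwv, map_mul (expSum Γ v),
      expSum_apply_of_mem_starConj hconn hstar φ.2, mul_comm]

theorem starExp_eq [Finite V] (htf : Γ.CliqueFree 3) (hconn : Γ.Connected)
    (hstar : ¬ ∃ c, IsStarGraph Γ c) {v w : V} (hw : HasMaximalLink Γ w) (hwv : w ≠ v)
    (φ : starConj Γ) {h : RAAG Γ} (hh : ConjOnStar φ.1 w h) :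
    starExp htf hconn hstar hw hwv φ = expSum Γ v h :=
  (φ.2 w hw).choose_spec.expSum_eq htf hconn hstar hw hh hwv

/-- The non-leaf components of `Γ − {v}`. -/
def nonleafComponents (Γ : SimpleGraph V) (v : V) : Set (Set V) :=
  {C | IsComponentOf Γ {v}ᶜ C ∧ ¬ ∃ w, C = {w}}

/-- For every vertex of `V0`, the non-leaf components other than the chosen one `base v`. -/
abbrev ComponentIndex (Γ : SimpleGraph V) (V0 : Finset V) (base : V → Set V) : Type _ :=
  Σ v : V0, {C : Set V // C ∈ nonleafComponents Γ v \ {base v}}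

theorem card_componentIndex [Finite V] (hconn : Γ.Connected) (V0 : Finset V) {base : V → Set V}
    (hbase : ∀ v, base v ∈ nonleafComponents Γ v) :
    (Nat.card (ComponentIndex Γ V0 base) : ℤ) =
      ∑ v ∈ V0, ((deltaC Γ v : ℤ) - (nAdjLeaves Γ v : ℤ) - 1) := by
  rw [Nat.card_sigma, Nat.cast_sum, ← Finset.sum_coe_sort V0]
  congr 1
  funext v
  rw [Nat.card_coe_set_eq, deltaC_eq hconn, ← nonleafComponents,
    ← Set.ncard_sdiff_singleton_add_one (hbase v)]
  push_cast
  ring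

theorem exists_partialConj_of_index {V0 : Finset V} {base : V → Set V}
    (hbase : ∀ v, base v ∈ nonleafComponents Γ v) (i : ComponentIndex Γ V0 base) :
    ∃ φ : starConj Γ, IsPartialConjBy Γ φ.1 i.1 i.2.1 ∧
      QuotientGroup.mk' (Inn (RAAG Γ)) φ.1 ∈ K0gens Γ := by
  obtain ⟨v, C, hC, hCb⟩ := i
  obtain ⟨φ, hφ⟩ := exists_isPartialConjBy (Γ := Γ) (v := v.1) (C := C) (fun h => hC.1.1 h rfl)
    fun x hx y hy hxy => Or.inl (by_contra fun h => hy (hC.1.2.2.2 x hx y h hxy))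
  exact ⟨⟨φ, fun w _ => ⟨_, hφ.conjOnStar hC.1 w⟩⟩, hφ, φ, rfl, v, C,
    hC.1.isSeparating (hbase v).1 hCb, hC.1, hC.2, hφ⟩

section Hom

variable [Finite V] (htf : Γ.CliqueFree 3) (hconn : Γ.Connected) (hstar : ¬ ∃ c, IsStarGraph Γ c)
  (V0 : Finset V) {base : V → Set V} (hbase : ∀ v, base v ∈ nonleafComponents Γ v)
  {rep : V → Set V → V}
  (hrep : ∀ v, ∀ C ∈ nonleafComponents Γ v, rep v C ∈ C ∧ HasMaximalLink Γ (rep v C))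

/-- The exponents of an element of `starConj Γ` along the non-leaf components. -/
def componentExp : starConj Γ →* (ComponentIndex Γ V0 base → Multiplicative ℤ) :=
  MonoidHom.pi fun i =>
    have hC := hrep i.1 i.2.1 i.2.2.1
    have hB := hrep i.1 (base i.1) (hbase i.1)
    starExp htf hconn hstar hC.2 (i.2.2.1.1.1 hC.1) / starExp htf hconn hstar hB.2
      ((hbase i.1).1.1 hB.1)

theorem componentExp_apply (φ : starConj Γ) (i : ComponentIndex Γ V0 base) {h k : RAAG Γ}
    (hh : ConjOnStar φ.1 (rep i.1 i.2.1) h) (hk : ConjOnStar φ.1 (rep i.1 (base i.1)) k) :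
    componentExp htf hconn hstar V0 hbase hrep φ i = expSum Γ i.1 h / expSum Γ i.1 k := by
  have hC := hrep i.1 i.2.1 i.2.2.1
  have hB := hrep i.1 (base i.1) (hbase i.1)
  exact congrArg₂ (· / ·) (starExp_eq htf hconn hstar hC.2 (i.2.2.1.1.1 hC.1) φ hh)
    (starExp_eq htf hconn hstar hB.2 ((hbase i.1).1.1 hB.1) φ hk)

open Classical in
theorem componentExp_partialConj (φ : starConj Γ) (i : ComponentIndex Γ V0 base)
    (hφ : IsPartialConjBy Γ φ.1 i.1 i.2.1) :
    componentExp htf hconn hstar V0 hbase hrep φ = Pi.mulSingle i (Multiplicative.ofAdd (-1)) := by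
  obtain ⟨v, C, hC⟩ := i
  funext ⟨v', C', hC'⟩
  have hB := hrep _ _ (hbase v)
  rw [componentExp_apply htf hconn hstar V0 hbase hrep φ _ (hφ.conjOnStar hC.1.1 _)
    (hφ.conjOnStar hC.1.1 _)]
  by_cases hv : v' = v
  · subst hv
    have hBC : rep v' (base v') ∉ C := fun h => hC.2 (hC.1.1.eq_of_mem (hbase v').1 h hB.1)
    by_cases hCC : C' = C
    · subst hCC
      simp [hBC, (hrep _ _ hC.1).1]
    · have : rep v' C' ∉ C := fun h => hCC (hC'.1.1.eq_of_mem hC.1.1 (hrep _ _ hC'.1).1 h)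
      have hne : (⟨v', C', hC'⟩ : ComponentIndex Γ V0 base) ≠ ⟨v', C, hC⟩ :=
        fun e => hCC (Subtype.ext_iff.1 (eq_of_heq (Sigma.mk.inj e).2))
      rw [Pi.mulSingle_eq_of_ne hne]
      simp [hBC, this]
  · have hv2 : (v : V) ≠ v' := fun e => hv (Subtype.ext e.symm)
    rw [Pi.mulSingle_eq_of_ne fun e => hv (congrArg Sigma.fst e)]
    split_ifs <;> simp [expSum_gen_of_ne hv2]

theorem componentExp_eq_one_iff (hV0 : IsV0 Γ ↑V0) (φ : starConj Γ) :
    componentExp htf hconn hstar V0 hbase hrep φ = 1 ↔ φ.1 ∈ Inn (RAAG Γ) := by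
  constructor
  · intro hone
    choose! h hh using φ.2
    refine mem_inn_of_expSum_eq htf hconn hstar hh fun v hv => ?_
    suffices ∀ w, HasMaximalLink Γ w → w ≠ v →
        expSum Γ v (h w) = expSum Γ v (h (rep v (base v))) from
      fun w w' hw hw' hwv hwv' => (this w hw hwv).trans (this w' hw' hwv').symm
    intro w hw hwv
    have hB := hrep v _ (hbase v)
    obtain ⟨C, hC, hwC⟩ := exists_isComponentOf (Γ := Γ) (S := {v}ᶜ) hwv
    by_cases hCb : C = base v
    · exact expSum_eq_of_component htf hconn hstar hh hC hwC (hCb ▸ hB.1) hw hB.2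
    obtain ⟨y, hwy, hyv⟩ := hw.exists_adj_ne hconn hstar v
    have hC' : C ∈ nonleafComponents Γ v := ⟨hC, hC.not_singleton hwC hyv hwy⟩
    have hvV0 := hV0.mem_of_isSeparating hconn hstar (hC.isSeparating (hbase v).1 hCb)
    have hR := hrep v C hC'
    rw [expSum_eq_of_component htf hconn hstar hh hC hwC hR.1 hw hR.2]
    have := congrFun hone ⟨⟨v, hvV0⟩, C, hC', hCb⟩
    rw [componentExp_apply htf hconn hstar V0 hbase hrep φ _ (hh _ hR.2) (hh _ hB.2)] at this
    exact div_eq_one.1 this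
  · rintro ⟨g, hg⟩
    funext i
    have hφ : ∀ w, ConjOnStar φ.1 w g := fun w => hg ▸ conjOnStar_conj g w
    rw [componentExp_apply htf hconn hstar V0 hbase hrep φ i (hφ _) (hφ _), div_self']
    rfl

theorem map_componentExp_eq_top :
    (((Subgroup.closure (K0gens Γ)).comap (QuotientGroup.mk' (Inn (RAAG Γ)))).subgroupOf
      (starConj Γ)).map (componentExp htf hconn hstar V0 hbase hrep) = ⊤ := by
  classical
  refine eq_top_iff.2 fun x _ => Subgroup.pi_mem_of_mulSingle_mem x fun i => ?_
  obtain ⟨φ, hφ, hgen⟩ := exists_partialConj_of_index hbase i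
  have := componentExp_partialConj htf hconn hstar V0 hbase hrep φ i hφ
  have e : Pi.mulSingle i (x i) =
      (Pi.mulSingle i (Multiplicative.ofAdd (-1)) : ComponentIndex Γ V0 base → Multiplicative ℤ) ^
        (-(x i).toAdd) := by
    rw [← Pi.mulSingle_zpow, ← ofAdd_zsmul]
    simp
  rw [e, ← this]
  exact zpow_mem (Subgroup.mem_map.2
    ⟨φ, Subgroup.mem_subgroupOf.2 (Subgroup.mem_comap.2 (Subgroup.subset_closure hgen)), rfl⟩) _

end Hom

variable [Finite V]

theorem closure_K0gens_eq_map_starConj (htf : Γ.CliqueFree 3) (hconn : Γ.Connected)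
    (hstar : ¬ ∃ c, IsStarGraph Γ c) (V0 : Finset V) {base : V → Set V}
    (hbase : ∀ v, base v ∈ nonleafComponents Γ v) {rep : V → Set V → V}
    (hrep : ∀ v, ∀ C ∈ nonleafComponents Γ v, rep v C ∈ C ∧ HasMaximalLink Γ (rep v C))
    (hV0 : IsV0 Γ ↑V0) :
    Subgroup.closure (K0gens Γ) = (starConj Γ).map (QuotientGroup.mk' (Inn (RAAG Γ))) := by
  refine le_antisymm ((Subgroup.closure_le _).2 ?_) ?_
  · rintro _ ⟨φ, rfl, v, C, -, hC, -, hφ⟩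
    exact ⟨φ, fun w _ => ⟨_, hφ.conjOnStar hC w⟩, rfl⟩
  · rintro _ ⟨φ, hφ, rfl⟩
    obtain ⟨ψ, hψ, e⟩ := (map_componentExp_eq_top htf hconn hstar V0 hbase hrep).ge
      (Subgroup.mem_top (componentExp htf hconn hstar V0 hbase hrep ⟨φ, hφ⟩))
    have h1 : componentExp htf hconn hstar V0 hbase hrep (ψ⁻¹ * ⟨φ, hφ⟩) = 1 := by
      rw [map_mul, map_inv, e, inv_mul_cancel]
    have h2 := (componentExp_eq_one_iff htf hconn hstar V0 hbase hrep hV0 _).1 h1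
    rw [show QuotientGroup.mk' (Inn (RAAG Γ)) φ = QuotientGroup.mk' _ ψ.1 from
      (QuotientGroup.eq.2 h2).symm]
    exact hψ

theorem nonempty_closure_K0gens_mulEquiv (htf : Γ.CliqueFree 3) (hconn : Γ.Connected)
    (hstar : ¬ ∃ c, IsStarGraph Γ c) (V0 : Finset V) {base : V → Set V}
    (hbase : ∀ v, base v ∈ nonleafComponents Γ v) {rep : V → Set V → V}
    (hrep : ∀ v, ∀ C ∈ nonleafComponents Γ v, rep v C ∈ C ∧ HasMaximalLink Γ (rep v C))
    (hV0 : IsV0 Γ ↑V0) :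
    Nonempty (Subgroup.closure (K0gens Γ) ≃* (ComponentIndex Γ V0 base → Multiplicative ℤ)) := by
  have hT := closure_K0gens_eq_map_starConj htf hconn hstar V0 hbase hrep hV0
  let π := (QuotientGroup.mk' (Inn (RAAG Γ))).subgroupMap (starConj Γ)
  let f := componentExp htf hconn hstar V0 hbase hrep
  have hf : Function.Surjective f := fun x => by
    obtain ⟨ψ, -, e⟩ := (map_componentExp_eq_top htf hconn hstar V0 hbase hrep).ge
      (Subgroup.mem_top x)
    exact ⟨ψ, e⟩
  have hker : π.ker = f.ker := by
    ext φ
    rw [MonoidHom.mem_ker, MonoidHom.mem_ker,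
      componentExp_eq_one_iff htf hconn hstar V0 hbase hrep hV0]
    exact Subtype.ext_iff.trans (QuotientGroup.eq_one_iff φ.1)
  exact ⟨(MulEquiv.subgroupCongr hT).trans <|
    (QuotientGroup.quotientKerEquivOfSurjective π (MonoidHom.subgroupMap_surjective _ _)).symm.trans
      <| (QuotientGroup.quotientMulEquivOfEq hker).trans
        (QuotientGroup.quotientKerEquivOfSurjective f hf)⟩

end Kernel

/-- The kernel `K_0` of `R_0` is a finitely generated free abelian group, generated
by the classes of partial conjugations by separating vertices `v` of single non-leaf
components of `Γ − {v}`; it is trivial if `Γ` is a star, and otherwise has rank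
`Σ_{v ∈ V0} (δ_C(v) − ℓ(v) − 1)`. -/
theorem kernel_R0_free_abelian {V : Type*} [Fintype V] (Γ : SimpleGraph V)
    (hconn : Γ.Connected) (htf : Γ.CliqueFree 3) (hE : 2 ≤ Γ.edgeSet.ncard)
    (V0 : Finset V) (hV0 : IsV0 Γ ↑V0) :
    ((Subgroup.closure (K0gens Γ) : Subgroup (Out (RAAG Γ))) : Set (Out (RAAG Γ)))
        = K0Set Γ ↑V0 ∧
    ((∃ c, IsStarGraph Γ c) → K0Set Γ ↑V0 = {1}) ∧
    ((¬ ∃ c, IsStarGraph Γ c) →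
      ∃ n : ℕ, (n : ℤ) = ∑ v ∈ V0, ((deltaC Γ v : ℤ) - (nAdjLeaves Γ v : ℤ) - 1) ∧
        Nonempty (Subgroup.closure (K0gens Γ) ≃* Multiplicative (Fin n → ℤ))) := by
  by_cases hstar : ∃ c, IsStarGraph Γ c
  · have h1 := K0Set_eq_one_of_star hV0 hstar
    refine ⟨Set.Subset.antisymm (closure_K0gens_le hconn hE hV0) ?_, fun _ => h1,
      fun h => absurd hstar h⟩
    rw [h1]
    exact Set.singleton_subset_iff.2 (one_mem _)
  choose base hbase using exists_nonleaf_component hconn hstar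
  choose! rep hrep using fun v C (hC : C ∈ nonleafComponents Γ v) =>
    exists_maximalLink_mem_component hC.1 hC.2
  refine ⟨Set.Subset.antisymm (closure_K0gens_le hconn hE hV0) ?_, fun h => absurd h hstar,
    fun _ => ⟨_, card_componentIndex hconn V0 hbase, ?_⟩⟩
  · rw [closure_K0gens_eq_map_starConj htf hconn hstar V0 hbase hrep hV0]
    exact K0Subgroup_le_map_starConj hV0 hstar
  · obtain ⟨e⟩ := nonempty_closure_K0gens_mulEquiv htf hconn hstar V0 hbase hrep hV0
    exact ⟨e.trans <| (MulEquiv.arrowCongr (Finite.equivFin _)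
      (MulEquiv.refl _)).trans (MulEquiv.piMultiplicative _).symm⟩
end
end

section
/- Let Γ be a finite connected triangle-free simplicial graph and let v and w be interior vertices joined by an edge of Γ. Then L_v⊥ ⊆ L_w (every vertex adjacent to all of lk(v) lies in lk(w)), and consequently the full subgraphs J_v = L_v * L_v⊥ and J_w = L_w⊥ * L_w satisfy J_v ∩ J_w = L_w⊥ * L_v⊥, i.e., the vertex set of J_v ∩ J_w is L_w⊥ ∪ L_v⊥. -/
noncomputable section

/-! ### Right-angled Artin groups -/

variable {V : Type*}

theorem mem_perp_iff (Γ : SimpleGraph V) (Θ : Set V) (x : V) :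
    x ∈ perp Γ Θ ↔ ∀ u ∈ Θ, x = u ∨ Γ.Adj u x := by
  simp [perp, starOf]

theorem not_adj_of_common_neighbor {Γ : SimpleGraph V} (htf : Γ.CliqueFree 3) {a b c : V}
    (hab : Γ.Adj a b) (hac : Γ.Adj a c) : ¬ Γ.Adj b c := by
  classical
  exact fun hbc => htf {a, b, c} (SimpleGraph.is3Clique_triple_iff.2 ⟨hab, hac, hbc⟩)

/-- In a triangle-free graph, the perp of the link of an interior vertex lies in the link of
each of its neighbors. -/
theorem perp_lk_subset_lk {Γ : SimpleGraph V} (htf : Γ.CliqueFree 3) {v w : V}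
    (hv : ¬ IsLeaf Γ v) (hvw : Γ.Adj v w) : perp Γ (lk Γ v) ⊆ lk Γ w := by
  intro x hx
  rw [mem_perp_iff] at hx
  rcases hx w hvw with rfl | h
  · refine absurd ⟨x, Set.Subset.antisymm (fun u hu => ?_) (by simpa using hvw)⟩ hv
    rcases hx u hu with rfl | h
    · rfl
    · exact absurd h (not_adj_of_common_neighbor htf hu hvw)
  · exact h

/-- If `v` and `w` are interior vertices joined by an edge of a connected
triangle-free graph, then `L_v⊥ ⊆ L_w` and `J_v ∩ J_w = L_w⊥ ∪ L_v⊥`. -/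
theorem perp_subset_link_of_adj {V : Type*} [Fintype V] (Γ : SimpleGraph V)
    (hconn : Γ.Connected) (htf : Γ.CliqueFree 3)
    (v w : V) (hv : ¬ IsLeaf Γ v) (hw : ¬ IsLeaf Γ w) (hvw : Γ.Adj v w) :
    perp Γ (lk Γ v) ⊆ lk Γ w ∧
    JoinOf Γ v ∩ JoinOf Γ w = perp Γ (lk Γ w) ∪ perp Γ (lk Γ v) := by
  have hvs := perp_lk_subset_lk htf hv hvw
  have hws := perp_lk_subset_lk htf hw hvw.symm
  refine ⟨hvs, Set.Subset.antisymm ?_ ?_⟩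
  · rintro x ⟨hxv | hxv, hxw | hxw⟩
    · exact absurd hxw (not_adj_of_common_neighbor htf hvw hxv)
    · exact Or.inl hxw
    · exact Or.inr hxv
    · exact Or.inl hxw
  · rintro x (hx | hx)
    · exact ⟨Or.inl (hws hx), Or.inr hx⟩
    · exact ⟨Or.inr hx, Or.inl (hvs hx)⟩
end
end
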